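/- Let k ≥ 2, let G be a bipartite graph of order N, and let G' be the graph obtained from G by attaching to each vertex v of G exactly k − 1 new pendant vertices, each adjacent only to v. If G has a dominating set of size ℓ, then G' has a k-rainbow independent dominating function of weight (k−1)N + ℓ. -/

import Mathlib

open scoped Classical

/-- A `k`-rainbow independent dominating function of `G`: values in `{0,...,k}`,
each nonzero colour class is independent, and every vertex of value `0` has,
for each `i ∈ {1,...,k}`, a neighbor of value `i`. -/
def IsKRiDF {V : Type*} (G : SimpleGraph V) (k : ℕ) (f : V → ℕ) : Prop :=
  (∀ v, f v ≤ k) ∧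
  (∀ i, 1 ≤ i → i ≤ k → ∀ u v, f u = i → f v = i → ¬ G.Adj u v) ∧
  (∀ v, f v = 0 → ∀ i, 1 ≤ i → i ≤ k → ∃ u, G.Adj v u ∧ f u = i)

/-- The weight of a labelling: the number of vertices with nonzero value. -/
noncomputable def riWeight {V : Type*} [Fintype V] (f : V → ℕ) : ℕ :=
  (Finset.univ.filter fun v => f v ≠ 0).card

/-- The `k`-rainbow independent domination number. -/
noncomputable def riNumber {V : Type*} [Fintype V] (G : SimpleGraph V) (k : ℕ) : ℕ :=
  sInf {w | ∃ f, IsKRiDF G k f ∧ riWeight f = w}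

/-- The star `S_m = K_{1,m}` on `Fin (m+1)` with centre `0`. -/
def starGraph (m : ℕ) : SimpleGraph (Fin (m + 1)) :=
  SimpleGraph.fromRel (fun a b => (a : ℕ) = 0 ∧ (b : ℕ) ≠ 0)

/-- The star `S_m` with one extra edge between the leaves `1` and `2`. -/
def starPlusGraph (m : ℕ) : SimpleGraph (Fin (m + 1)) :=
  SimpleGraph.fromRel (fun a b => ((a : ℕ) = 0 ∧ (b : ℕ) ≠ 0) ∨ ((a : ℕ) = 1 ∧ (b : ℕ) = 2))

/-- The double star `S(n,m)`: centres `0` (with leaves `2,...,n+1`) and `1`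
(with leaves `n+2,...,n+m+1`), joined by the bridge `01`. -/
def doubleStar (n m : ℕ) : SimpleGraph (Fin (n + m + 2)) :=
  SimpleGraph.fromRel (fun a b =>
    ((a : ℕ) = 0 ∧ (b : ℕ) = 1) ∨
    ((a : ℕ) = 0 ∧ 2 ≤ (b : ℕ) ∧ (b : ℕ) < n + 2) ∨
    ((a : ℕ) = 1 ∧ n + 2 ≤ (b : ℕ)))

/-- The graph obtained from `G` by attaching `m` new pendant vertices to each
vertex of `G`; the pendant `(v, i)` is adjacent only to `v`. -/
def attachPendants {V : Type*} (G : SimpleGraph V) (m : ℕ) :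
    SimpleGraph (V ⊕ (V × Fin m)) :=
  SimpleGraph.fromRel (fun a b =>
    match a, b with
    | Sum.inl u, Sum.inl v => G.Adj u v
    | Sum.inl u, Sum.inr p => p.1 = u
    | Sum.inr _, _ => False)

@[simp]
theorem attachPendants_adj_inl_inl {V : Type*} (G : SimpleGraph V) (m : ℕ) (u v : V) :
    (attachPendants G m).Adj (Sum.inl u) (Sum.inl v) ↔ G.Adj u v := by
  simp only [attachPendants, SimpleGraph.fromRel_adj, ne_eq, Sum.inl.injEq, G.adj_comm v u,
    or_self, and_iff_right_iff_imp]
  exact fun h => h.ne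

@[simp]
theorem attachPendants_adj_inl_inr {V : Type*} (G : SimpleGraph V) (m : ℕ) (u : V)
    (p : V × Fin m) : (attachPendants G m).Adj (Sum.inl u) (Sum.inr p) ↔ p.1 = u := by
  simp [attachPendants]

@[simp]
theorem attachPendants_adj_inr_inl {V : Type*} (G : SimpleGraph V) (m : ℕ) (u : V)
    (p : V × Fin m) : (attachPendants G m).Adj (Sum.inr p) (Sum.inl u) ↔ p.1 = u := by
  simp [attachPendants]

@[simp]
theorem attachPendants_not_adj_inr_inr {V : Type*} (G : SimpleGraph V) (m : ℕ)
    (p q : V × Fin m) : ¬ (attachPendants G m).Adj (Sum.inr p) (Sum.inr q) := by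
  simp [attachPendants]

/-- The `i`-th element of `{1, 2, ...} \ {a}`, counting from `0`. -/
def colorAvoiding (a i : ℕ) : ℕ := if i + 1 < a then i + 1 else i + 2

/-- Vertices of `D` keep their colour `c v`, other vertices of `G` get `0`, and the pendants
at `v` get the colours other than `a v`. -/
noncomputable def pendantLabelling {V : Type*} (D : Finset V) (c a : V → ℕ) (m : ℕ) :
    V ⊕ (V × Fin m) → ℕ :=
  Sum.elim (fun v => if v ∈ D then c v else 0) (fun p => colorAvoiding (a p.1) p.2)

theorem colorAvoiding_ne_zero (a i : ℕ) : colorAvoiding a i ≠ 0 := by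
  unfold colorAvoiding; split_ifs <;> omega

theorem colorAvoiding_ne (a i : ℕ) : colorAvoiding a i ≠ a := by
  unfold colorAvoiding; split_ifs <;> omega

theorem exists_colorAvoiding_eq {a k j : ℕ} (ha : 1 ≤ a) (hak : a ≤ k) (hj : 1 ≤ j)
    (hjk : j ≤ k) (hja : j ≠ a) : ∃ i : Fin (k - 1), colorAvoiding a i = j := by
  rcases lt_or_gt_of_ne hja with h | h
  · refine ⟨⟨j - 1, by omega⟩, ?_⟩
    simp only [colorAvoiding]
    split_ifs <;> omega
  · refine ⟨⟨j - 2, by omega⟩, ?_⟩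
    simp only [colorAvoiding]
    split_ifs <;> omega

theorem isKRiDF_pendantLabelling {V : Type*} {G : SimpleGraph V} {k : ℕ} {D : Finset V}
    {c a : V → ℕ} (hc : ∀ v, 1 ≤ c v ∧ c v ≤ k) (hcG : ∀ u v, G.Adj u v → c u ≠ c v)
    (ha : ∀ v, 1 ≤ a v ∧ a v ≤ k) (haD : ∀ v ∈ D, a v = c v)
    (hdom : ∀ v ∉ D, ∃ d ∈ D, G.Adj v d ∧ c d = a v) :
    IsKRiDF (attachPendants G (k - 1)) k (pendantLabelling D c a (k - 1)) := by
  have pendant_ne : ∀ v i, v ∈ D → colorAvoiding (a v) i ≠ c v := fun v i hv =>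
    haD v hv ▸ colorAvoiding_ne (a v) i
  refine ⟨?_, ?_, ?_⟩
  · rintro (v | ⟨v, i⟩)
    · have := hc v
      simp only [pendantLabelling, Sum.elim_inl]
      split_ifs <;> omega
    · have := i.isLt
      simp only [pendantLabelling, Sum.elim_inr, colorAvoiding]
      split_ifs <;> omega
  · rintro j hj - (u | ⟨u, i⟩) (v | ⟨v, i'⟩) hu hv hadj <;>
      simp only [pendantLabelling, Sum.elim_inl, Sum.elim_inr] at hu hv
    · rw [attachPendants_adj_inl_inl] at hadj
      split_ifs at hu hv <;> first | omega | exact hcG u v hadj (hu.trans hv.symm)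
    · obtain rfl : v = u := by simpa using hadj
      split_ifs at hu with hD
      · exact pendant_ne _ _ hD (hv.trans hu.symm)
      · omega
    · obtain rfl : u = v := by simpa using hadj
      split_ifs at hv with hD
      · exact pendant_ne _ _ hD (hu.trans hv.symm)
      · omega
    · simp at hadj
  · rintro (v | ⟨v, i⟩) hv j hj hjk
    · have hvD : v ∉ D := fun h => by
        have := hc v
        simp only [pendantLabelling, Sum.elim_inl, if_pos h] at hv
        omega
      by_cases hja : j = a v
      · obtain ⟨d, hd, hadj, hcd⟩ := hdom v hvD
        exact ⟨Sum.inl d, by simpa using hadj, by simp [pendantLabelling, hd, hcd, hja]⟩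
      · obtain ⟨i, hi⟩ := exists_colorAvoiding_eq (ha v).1 (ha v).2 hj hjk hja
        exact ⟨Sum.inr (v, i), by simp, by simpa [pendantLabelling] using hi⟩
    · exact absurd hv (colorAvoiding_ne_zero _ _)

theorem riWeight_pendantLabelling {V : Type*} [Fintype V] (D : Finset V) {c : V → ℕ}
    (a : V → ℕ) (m : ℕ) (hc : ∀ v, c v ≠ 0) :
    riWeight (pendantLabelling D c a m) = m * Fintype.card V + D.card := by
  have hsupp : (Finset.univ.filter fun x => pendantLabelling D c a m x ≠ 0) =
      D.disjSum Finset.univ := by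
    ext (v | p) <;> rw [Finset.mem_filter] <;> simp [pendantLabelling, hc, colorAvoiding_ne_zero]
  rw [riWeight, hsupp, Finset.card_disjSum, Finset.card_univ, Fintype.card_prod, Fintype.card_fin,
    mul_comm, add_comm]

theorem stmt_12 {V : Type*} [Fintype V] (G : SimpleGraph V) (k ℓ : ℕ)
    (hk : 2 ≤ k) (hbip : G.Colorable 2)
    (D : Finset V) (hdom : ∀ v : V, v ∈ D ∨ ∃ d ∈ D, G.Adj v d)
    (hD : D.card = ℓ) :
    ∃ f : V ⊕ (V × Fin (k - 1)) → ℕ,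
      IsKRiDF (attachPendants G (k - 1)) k f ∧
      riWeight f = (k - 1) * Fintype.card V + ℓ := by
  obtain ⟨C⟩ := hbip
  have hC : ∀ u v, G.Adj u v → (C u : ℕ) ≠ C v := fun u v h e => C.valid h (Fin.ext e)
  have hlt : ∀ v, (C v : ℕ) < 2 := fun v => (C v).isLt
  let c : V → ℕ := fun v => C v + 1
  let a : V → ℕ := fun v => if v ∈ D then c v else 3 - c v
  refine ⟨pendantLabelling D c a (k - 1), isKRiDF_pendantLabelling ?_ ?_ ?_ ?_ ?_, ?_⟩
  · intro v
    have := hlt v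
    simp only [c]
    omega
  · intro u v h
    simpa [c, Fin.val_inj] using hC u v h
  · intro v
    have := hlt v
    simp only [a, c]
    split_ifs <;> omega
  · intro v hv
    simp only [a, if_pos hv]
  · intro v hv
    obtain ⟨d, hd, hadj⟩ := (hdom v).resolve_left hv
    refine ⟨d, hd, hadj, ?_⟩
    have := hlt v
    have := hlt d
    have := hC v d hadj
    simp only [a, c, if_neg hv]
    omega
  · rw [riWeight_pendantLabelling D a (k - 1) (fun v => Nat.succ_ne_zero _), hD]
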